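/- Let a, b ∈ ℂ with a ≠ 0, b ≠ 0 and |a|² + |b|² = 1, and let φ = (φ₁, φ₂) be a unit vector in ℂ². Then the probability measures Σ_{x∈ℤ} p_nᴬ(φ;x) δ_{x/n} converge weakly as n → ∞ to the absolutely continuous measure on ℝ with density y ↦ χ_{(−|a|,|a|)}(y) · |b|(1 + λ_A(φ) y) / (π (1 − y²) √(|a|² − y²)), where λ_A(φ) = |φ₁|² − |φ₂|² − (1/|a|²)(a b φ̄₁ φ₂ + ā b̄ φ₁ φ̄₂). Equivalently, for every bounded continuous function f : ℝ → ℝ, Σ_{x∈ℤ} p_nᴬ(φ;x) f(x/n) → ∫_{−|a|}^{|a|} f(y) · |b|(1 + λ_A(φ) y) / (π (1 − y²) √(|a|² − y²)) dy. -/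

import Mathlib

/-- The unitary evolution `U(A) = P_A τ + Q_A τ⁻¹` of the one-dimensional quantum walk
associated to the matrix `A = [[a, b], [-b̄, ā]]`, acting on `ℂ²`-valued functions on `ℤ`:
`(U(A) f)(x) = P_A f(x-1) + Q_A f(x+1)`. -/
noncomputable def qwEvol (a b : ℂ) (f : ℤ → Fin 2 → ℂ) : ℤ → Fin 2 → ℂ :=
  fun x => ![a * f (x - 1) 0 + b * f (x + 1) 1,
             -(starRingEnd ℂ) b * f (x - 1) 0 + (starRingEnd ℂ) a * f (x + 1) 1]

/-- The initial state `δ₀ ⊗ φ`. -/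
noncomputable def qwInit (φ₁ φ₂ : ℂ) : ℤ → Fin 2 → ℂ :=
  fun y => if y = 0 then ![φ₁, φ₂] else 0

/-- The transition probability `p_n^A(φ; x) = ‖(U(A)^n (δ₀ ⊗ φ))(x)‖²_{ℂ²}`. -/
noncomputable def qwProb (a b : ℂ) (φ₁ φ₂ : ℂ) (n : ℕ) (x : ℤ) : ℝ :=
  ‖(qwEvol a b)^[n] (qwInit φ₁ φ₂) x 0‖ ^ 2 + ‖(qwEvol a b)^[n] (qwInit φ₁ φ₂) x 1‖ ^ 2

open Filter Topology MeasureTheory ComplexConjugate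

/-- After `n` steps the walk started at the origin is supported in `[-n, n]`. -/
lemma qwEvol_iterate_eq_zero (a b φ₁ φ₂ : ℂ) (n : ℕ) {x : ℤ}
    (hx : x ∉ Finset.Icc (-n : ℤ) n) : (qwEvol a b)^[n] (qwInit φ₁ φ₂) x = 0 := by
  induction n generalizing x with
  | zero =>
    have : x ≠ 0 := by simpa using hx
    simp [qwInit, this]
  | succ n ih =>
    rw [Function.iterate_succ_apply']
    simp only [Finset.mem_Icc, not_and_or, not_le] at hx ih
    push_cast at hx
    ext i
    fin_cases i <;> simp [qwEvol, ih (x := x - 1) (by omega), ih (x := x + 1) (by omega)]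

/-- Gauge covariance of the walk under multiplication by site- and component-dependent phases. -/
lemma qwEvol_gauge {u v : ℂ} (hu : ‖u‖ = 1) (hv : ‖v‖ = 1) (a b : ℂ) (f : ℤ → Fin 2 → ℂ) :
    qwEvol (a * u) (b * u⁻¹ * v⁻¹) (fun x => ![u ^ x * f x 0, u ^ x * v * f x 1]) =
      fun x => ![u ^ x * qwEvol a b f x 0, u ^ x * v * qwEvol a b f x 1] := by
  have hu0 : u ≠ 0 := by rintro rfl; simp at hu
  have hv0 : v ≠ 0 := by rintro rfl; simp at hv
  have hu' : conj u = u⁻¹ := (Complex.inv_eq_conj hu).symm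
  have hv' : conj v = v⁻¹ := (Complex.inv_eq_conj hv).symm
  ext x i
  fin_cases i
  · simp [qwEvol, zpow_sub_one₀ hu0, zpow_add_one₀ hu0]
    field_simp
  · simp [qwEvol, zpow_sub_one₀ hu0, zpow_add_one₀ hu0, hu', hv']
    field_simp

lemma qwProb_gauge {u v : ℂ} (hu : ‖u‖ = 1) (hv : ‖v‖ = 1) (a b φ₁ φ₂ : ℂ) (n : ℕ) (x : ℤ) :
    qwProb (a * u) (b * u⁻¹ * v⁻¹) φ₁ (v * φ₂) n x = qwProb a b φ₁ φ₂ n x := by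
  have key : (qwEvol (a * u) (b * u⁻¹ * v⁻¹))^[n] (qwInit φ₁ (v * φ₂)) =
      fun x => ![u ^ x * (qwEvol a b)^[n] (qwInit φ₁ φ₂) x 0,
        u ^ x * v * (qwEvol a b)^[n] (qwInit φ₁ φ₂) x 1] := by
    induction n with
    | zero =>
      ext x i
      by_cases hx : x = 0 <;> fin_cases i <;> simp [qwInit, hx]
    | succ n ih =>
      rw [Function.iterate_succ_apply', ih, qwEvol_gauge hu hv, Function.iterate_succ_apply']
  simp [qwProb, key, hu, hv]

/-- The Fourier series with coefficients `f`. -/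
noncomputable def fourierSum (f : ℤ → ℂ) (θ : ℝ) : ℂ :=
  ∑' x : ℤ, f x * Complex.exp (x * θ * Complex.I)

lemma fourierSum_eq_sum {f : ℤ → ℂ} {S : Finset ℤ} (hf : ∀ x ∉ S, f x = 0) (θ : ℝ) :
    fourierSum f θ = ∑ x ∈ S, f x * Complex.exp (x * θ * Complex.I) :=
  tsum_eq_sum fun x hx => by simp [hf x hx]

lemma fourierSum_add {f g : ℤ → ℂ} (hf : f.support.Finite) (hg : g.support.Finite) (θ : ℝ) :
    fourierSum (fun x => f x + g x) θ = fourierSum f θ + fourierSum g θ := by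
  simp only [fourierSum, add_mul]
  refine Summable.tsum_add (summable_of_hasFiniteSupport (hf.subset ?_))
    (summable_of_hasFiniteSupport (hg.subset ?_)) <;>
  exact Function.support_mul_subset_left _ _

lemma fourierSum_const_mul (c : ℂ) (f : ℤ → ℂ) (θ : ℝ) :
    fourierSum (fun x => c * f x) θ = c * fourierSum f θ := by
  simp only [fourierSum, mul_assoc, tsum_mul_left]

lemma fourierSum_shift (f : ℤ → ℂ) (k : ℤ) (θ : ℝ) :
    fourierSum (fun x => f (x - k)) θ = Complex.exp (k * θ * Complex.I) * fourierSum f θ := by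
  rw [fourierSum, fourierSum, ← (Equiv.addRight k).tsum_eq, ← tsum_mul_left]
  refine tsum_congr fun x => ?_
  simp only [Equiv.coe_addRight, add_sub_cancel_right, Int.cast_add, add_mul, Complex.exp_add]
  ring

lemma integral_exp_int_mul (m : ℤ) (c : ℝ) :
    ∫ θ in c..c + 2 * Real.pi, Complex.exp (m * θ * Complex.I) =
      if m = 0 then 2 * Real.pi else 0 := by
  split_ifs with hm
  · simp [hm]
  · have h0 : (m : ℂ) * Complex.I ≠ 0 := by simp [hm]
    have : ∀ θ : ℝ, Complex.exp (m * θ * Complex.I) = Complex.exp (m * Complex.I * θ) := fun θ => by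
      ring_nf
    simp_rw [this]
    rw [integral_exp_mul_complex h0]
    have : (m : ℂ) * Complex.I * ((c + 2 * Real.pi : ℝ) : ℂ) =
      m * Complex.I * c + m * (2 * Real.pi * Complex.I) := by push_cast; ring
    rw [this, Complex.exp_add, Complex.exp_int_mul_two_pi_mul_I]
    simp

/-- Parseval's identity for finite Fourier series, with a translation. -/
lemma integral_conj_fourierSum_mul {f : ℤ → ℂ} {S : Finset ℤ} (hf : ∀ x ∉ S, f x = 0) (c δ : ℝ) :
    ∫ θ in c..c + 2 * Real.pi, conj (fourierSum f θ) * fourierSum f (θ + δ) =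
      2 * Real.pi * ∑ x ∈ S, (‖f x‖ : ℂ) ^ 2 * Complex.exp (x * δ * Complex.I) := by
  simp_rw [fourierSum_eq_sum hf, map_sum, Finset.sum_mul_sum]
  have key : ∀ x y : ℤ, ∫ θ in c..c + 2 * Real.pi, conj (f x * Complex.exp (x * θ * Complex.I)) *
      (f y * Complex.exp (y * (θ + δ : ℝ) * Complex.I)) =
      if x = y then 2 * Real.pi * ((‖f x‖ : ℂ) ^ 2 * Complex.exp (x * δ * Complex.I)) else 0 := by
    intro x y
    have : ∀ θ : ℝ, conj (f x * Complex.exp (x * θ * Complex.I)) *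
      (f y * Complex.exp (y * (θ + δ : ℝ) * Complex.I)) =
      (conj (f x) * f y * Complex.exp (y * δ * Complex.I)) *
        Complex.exp ((y - x : ℤ) * θ * Complex.I) := by
      intro θ
      have : ((y - x : ℤ) : ℂ) * θ * Complex.I = y * θ * Complex.I + -(x * θ * Complex.I) := by
        push_cast; ring
      rw [this, Complex.exp_add, map_mul, ← Complex.exp_conj]
      simp only [map_mul, Complex.conj_I, Complex.conj_ofReal, map_intCast, Complex.ofReal_add,
        mul_add, add_mul, Complex.exp_add, mul_neg]
      ring
    simp_rw [this]
    rw [intervalIntegral.integral_const_mul, integral_exp_int_mul]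
    by_cases h : x = y
    · subst h
      simp [Complex.conj_mul']
      ring
    · simp [h, sub_eq_zero, Ne.symm h]
  rw [intervalIntegral.integral_finsetSum, Finset.mul_sum]
  · refine Finset.sum_congr rfl fun x hx => ?_
    rw [intervalIntegral.integral_finsetSum]
    · simp_rw [key]
      simp [hx]
    · intro y _
      exact Continuous.intervalIntegrable (by fun_prop) _ _
  · intro x _
    exact Continuous.intervalIntegrable (by fun_prop) _ _

/-- `√(s² + r² sin² θ)`, the sine of the quasi-energy of the real coin `[[r, s], [-s, r]]` at
momentum `θ`. -/
noncomputable def coinSin (r s θ : ℝ) : ℝ := √(s ^ 2 + r ^ 2 * Real.sin θ ^ 2)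

/-- The group velocity of the walk with real coin `[[r, s], [-s, r]]` at momentum `θ`. -/
noncomputable def coinVelocity (r s θ : ℝ) : ℝ := r * Real.sin θ / coinSin r s θ

/-- The first component of the quadrature partner `(U(θ) - cos ω) φ / sin ω` of `φ`. -/
noncomputable def coinQuad₀ (r s : ℝ) (φ₁ φ₂ : ℂ) (θ : ℝ) : ℂ :=
  (Complex.I * r * Real.sin θ * φ₁ + s * Complex.exp (-(θ * Complex.I)) * φ₂) / coinSin r s θ

/-- The second component of the quadrature partner `(U(θ) - cos ω) φ / sin ω` of `φ`. -/
noncomputable def coinQuad₁ (r s : ℝ) (φ₁ φ₂ : ℂ) (θ : ℝ) : ℂ :=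
  (-(s * Complex.exp (θ * Complex.I) * φ₁) - Complex.I * r * Real.sin θ * φ₂) / coinSin r s θ

/-- The quasi-energy at momentum `θ`. -/
noncomputable def coinEnergy (r θ : ℝ) : ℝ := Real.arccos (r * Real.cos θ)

/-- The polarisation of `φ` along the eigenbasis of the coin at momentum `θ`. -/
noncomputable def coinPol (r s : ℝ) (φ₁ φ₂ : ℂ) (θ : ℝ) : ℝ :=
  (r * Real.sin θ * (‖φ₁‖ ^ 2 - ‖φ₂‖ ^ 2) + 2 * s * ((conj φ₁ * φ₂).im * Real.cos θ
    - (conj φ₁ * φ₂).re * Real.sin θ)) / coinSin r s θ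

section RealCoin

variable {r s : ℝ}

lemma coinSin_pos (hs : 0 < s) (θ : ℝ) : 0 < coinSin r s θ :=
  Real.sqrt_pos.2 (by positivity)

lemma coinSin_sq (r s θ : ℝ) : coinSin r s θ ^ 2 = s ^ 2 + r ^ 2 * Real.sin θ ^ 2 :=
  Real.sq_sqrt (by positivity)

lemma continuous_coinSin : Continuous (coinSin r s) := by
  unfold coinSin; fun_prop

lemma continuous_coinVelocity (hs : 0 < s) : Continuous (coinVelocity r s) :=
  Continuous.div (by fun_prop) continuous_coinSin fun θ => (coinSin_pos hs θ).ne'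

lemma continuous_coinPol (hs : 0 < s) (φ₁ φ₂ : ℂ) : Continuous (coinPol r s φ₁ φ₂) :=
  Continuous.div (by fun_prop) continuous_coinSin fun θ => (coinSin_pos hs θ).ne'

lemma continuous_coinQuad₀ (hs : 0 < s) (φ₁ φ₂ : ℂ) : Continuous (coinQuad₀ r s φ₁ φ₂) :=
  Continuous.div (by fun_prop) (Complex.continuous_ofReal.comp continuous_coinSin) fun θ =>
    Complex.ofReal_ne_zero.2 (coinSin_pos hs θ).ne'

lemma continuous_coinQuad₁ (hs : 0 < s) (φ₁ φ₂ : ℂ) : Continuous (coinQuad₁ r s φ₁ φ₂) :=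
  Continuous.div (by fun_prop) (Complex.continuous_ofReal.comp continuous_coinSin) fun θ =>
    Complex.ofReal_ne_zero.2 (coinSin_pos hs θ).ne'

lemma abs_mul_cos_lt_one (hr : 0 < r) (hs : 0 < s) (hrs : r ^ 2 + s ^ 2 = 1) (θ : ℝ) :
    |r * Real.cos θ| < 1 := by
  have hr1 : r < 1 := by nlinarith [sq_nonneg s, pow_pos hs 2]
  rw [abs_mul, abs_of_pos hr]
  nlinarith [Real.abs_cos_le_one θ, abs_nonneg (Real.cos θ)]

lemma one_sub_mul_cos_sq (hrs : r ^ 2 + s ^ 2 = 1) (θ : ℝ) :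
    1 - (r * Real.cos θ) ^ 2 = s ^ 2 + r ^ 2 * Real.sin θ ^ 2 := by
  have := Real.sin_sq_add_cos_sq θ
  linear_combination -hrs - r ^ 2 * this

lemma cos_coinEnergy (hr : 0 < r) (hs : 0 < s) (hrs : r ^ 2 + s ^ 2 = 1) (θ : ℝ) :
    Real.cos (coinEnergy r θ) = r * Real.cos θ := by
  have h := abs_lt.1 (abs_mul_cos_lt_one hr hs hrs θ)
  exact Real.cos_arccos h.1.le h.2.le

lemma sin_coinEnergy (hrs : r ^ 2 + s ^ 2 = 1) (θ : ℝ) :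
    Real.sin (coinEnergy r θ) = coinSin r s θ := by
  rw [coinEnergy, Real.sin_arccos, one_sub_mul_cos_sq hrs, coinSin]

lemma hasDerivAt_coinEnergy (hr : 0 < r) (hs : 0 < s) (hrs : r ^ 2 + s ^ 2 = 1) (θ : ℝ) :
    HasDerivAt (coinEnergy r) (coinVelocity r s θ) θ := by
  have h := abs_lt.1 (abs_mul_cos_lt_one hr hs hrs θ)
  have := (Real.hasDerivAt_arccos h.1.ne' h.2.ne).comp θ ((Real.hasDerivAt_cos θ).const_mul r)
  rw [one_sub_mul_cos_sq hrs] at this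
  refine this.congr_deriv ?_
  simp only [coinVelocity, coinSin]
  ring

lemma exp_mul_I_eq (θ : ℝ) :
    Complex.exp (θ * Complex.I) = Real.cos θ + Real.sin θ * Complex.I := by
  rw [Complex.exp_mul_I, Complex.ofReal_cos, Complex.ofReal_sin]

lemma exp_neg_mul_I_eq (θ : ℝ) :
    Complex.exp (-(θ * Complex.I)) = Real.cos θ - Real.sin θ * Complex.I := by
  rw [← neg_mul, ← Complex.ofReal_neg, exp_mul_I_eq]
  simp [sub_eq_add_neg]

lemma finite_support_qwEvol_iterate (a b φ₁ φ₂ : ℂ) (n : ℕ) (i : Fin 2) :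
    (fun x => (qwEvol a b)^[n] (qwInit φ₁ φ₂) x i).support.Finite := by
  refine (Finset.finite_toSet (Finset.Icc (-n : ℤ) n)).subset fun x hx => ?_
  by_contra h
  exact hx (by simp [qwEvol_iterate_eq_zero a b φ₁ φ₂ n h])

lemma fourierSum_qwEvol_zero {a b : ℂ} {f : ℤ → Fin 2 → ℂ}
    (hf : ∀ i, (fun x => f x i).support.Finite) (θ : ℝ) :
    fourierSum (fun x => qwEvol a b f x 0) θ =
      a * Complex.exp (θ * Complex.I) * fourierSum (fun x => f x 0) θ +
      b * Complex.exp (-(θ * Complex.I)) * fourierSum (fun x => f x 1) θ := by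
  have h0 := fourierSum_shift (fun x => f x 0) 1 θ
  have h1 := fourierSum_shift (fun x => f x 1) (-1) θ
  have hs0 := (hf 0).preimage ((sub_left_injective (b := (1 : ℤ))).injOn)
  have hs1 := (hf 1).preimage ((add_left_injective (1 : ℤ)).injOn)
  simp only [sub_neg_eq_add, Int.cast_neg, Int.cast_one, one_mul, neg_mul] at h0 h1
  simp only [qwEvol, Matrix.cons_val_zero]
  rw [fourierSum_add, fourierSum_const_mul, fourierSum_const_mul, h0, h1]
  · ring
  · exact hs0.subset (Function.support_mul_subset_right _ _)
  · exact hs1.subset (Function.support_mul_subset_right _ _)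

lemma fourierSum_qwEvol_one {a b : ℂ} {f : ℤ → Fin 2 → ℂ}
    (hf : ∀ i, (fun x => f x i).support.Finite) (θ : ℝ) :
    fourierSum (fun x => qwEvol a b f x 1) θ =
      -conj b * Complex.exp (θ * Complex.I) * fourierSum (fun x => f x 0) θ +
      conj a * Complex.exp (-(θ * Complex.I)) * fourierSum (fun x => f x 1) θ := by
  have h0 := fourierSum_shift (fun x => f x 0) 1 θ
  have h1 := fourierSum_shift (fun x => f x 1) (-1) θ
  have hs0 := (hf 0).preimage ((sub_left_injective (b := (1 : ℤ))).injOn)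
  have hs1 := (hf 1).preimage ((add_left_injective (1 : ℤ)).injOn)
  simp only [sub_neg_eq_add, Int.cast_neg, Int.cast_one, one_mul, neg_mul] at h0 h1
  simp only [qwEvol, Matrix.cons_val_one, Matrix.cons_val_fin_one]
  rw [fourierSum_add, fourierSum_const_mul, fourierSum_const_mul, h0, h1]
  · ring
  · exact hs0.subset (Function.support_mul_subset_right _ _)
  · exact hs1.subset (Function.support_mul_subset_right _ _)

lemma fourierSum_qwInit (φ₁ φ₂ : ℂ) (i : Fin 2) (θ : ℝ) :
    fourierSum (fun x => qwInit φ₁ φ₂ x i) θ = ![φ₁, φ₂] i := by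
  rw [fourierSum_eq_sum (S := {0})]
  · simp [qwInit]
  · intro x hx
    simp [qwInit, Finset.mem_singleton.not.1 hx]

/-- Explicit diagonalisation of the walk in momentum space. -/
lemma fourierSum_qwEvol_iterate (hr : 0 < r) (hs : 0 < s) (hrs : r ^ 2 + s ^ 2 = 1)
    (φ₁ φ₂ : ℂ) (n : ℕ) (θ : ℝ) :
    fourierSum (fun x => (qwEvol r s)^[n] (qwInit φ₁ φ₂) x 0) θ =
        Real.cos (n * coinEnergy r θ) * φ₁ +
          Real.sin (n * coinEnergy r θ) * coinQuad₀ r s φ₁ φ₂ θ ∧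
      fourierSum (fun x => (qwEvol r s)^[n] (qwInit φ₁ φ₂) x 1) θ =
        Real.cos (n * coinEnergy r θ) * φ₂ +
          Real.sin (n * coinEnergy r θ) * coinQuad₁ r s φ₁ φ₂ θ := by
  have hw : (coinSin r s θ : ℂ) ≠ 0 := Complex.ofReal_ne_zero.2 (coinSin_pos hs θ).ne'
  have hw2 : (coinSin r s θ : ℂ) ^ 2 = s ^ 2 + r ^ 2 * (Real.sin θ : ℂ) ^ 2 := by
    exact_mod_cast coinSin_sq r s θ
  have hI := Complex.I_sq
  induction n with
  | zero => simp [fourierSum_qwInit]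
  | succ n ih =>
    have hf := finite_support_qwEvol_iterate r s φ₁ φ₂ n
    have ep := exp_mul_I_eq θ
    have em := exp_neg_mul_I_eq θ
    simp only [Function.iterate_succ_apply']
    rw [fourierSum_qwEvol_zero hf, fourierSum_qwEvol_one hf, ih.1, ih.2]
    have e1 : ((n + 1 : ℕ) : ℝ) * coinEnergy r θ = n * coinEnergy r θ + coinEnergy r θ := by
      push_cast; ring
    rw [e1, Real.cos_add, Real.sin_add, cos_coinEnergy hr hs hrs, sin_coinEnergy hrs]
    have hS : (Real.sin θ : ℂ) ^ 2 + (Real.cos θ : ℂ) ^ 2 = 1 := by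
      exact_mod_cast Real.sin_sq_add_cos_sq θ
    have hV₁ : coinSin r s θ * coinQuad₀ r s φ₁ φ₂ θ = Complex.I * r * Real.sin θ * φ₁ +
        s * (Real.cos θ - Real.sin θ * Complex.I) * φ₂ := by
      rw [coinQuad₀, em, mul_div_cancel₀ _ hw]
    have hV₂ : coinSin r s θ * coinQuad₁ r s φ₁ φ₂ θ =
        -(s * (Real.cos θ + Real.sin θ * Complex.I) * φ₁) - Complex.I * r * Real.sin θ * φ₂ := by
      rw [coinQuad₁, ep, mul_div_cancel₀ _ hw]
    simp only [Complex.conj_ofReal, ep, em, Complex.ofReal_sub, Complex.ofReal_add,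
      Complex.ofReal_mul]
    generalize (Real.cos (n * coinEnergy r θ) : ℂ) = c
    generalize (Real.sin (n * coinEnergy r θ) : ℂ) = d
    generalize coinQuad₀ r s φ₁ φ₂ θ = V₁ at *
    generalize coinQuad₁ r s φ₁ φ₂ θ = V₂ at *
    generalize (Real.cos θ : ℂ) = C at *
    generalize (Real.sin θ : ℂ) = S at *
    generalize (coinSin r s θ : ℂ) = w at *
    have hK₁ : Complex.I * r * S * V₁ + s * (C - S * Complex.I) * V₂ = -(w * φ₁) := by
      apply mul_left_cancel₀ hw
      linear_combination (Complex.I * r * S) * hV₁ + s * (C - S * Complex.I) * hV₂ + φ₁ * hw2 +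
        φ₁ * (r ^ 2 * S ^ 2 + s ^ 2 * S ^ 2) * hI - φ₁ * s ^ 2 * hS
    have hK₂ : -(s * (C + S * Complex.I) * V₁) - Complex.I * r * S * V₂ = -(w * φ₂) := by
      apply mul_left_cancel₀ hw
      linear_combination -(s * (C + S * Complex.I)) * hV₁ - (Complex.I * r * S) * hV₂ + φ₂ * hw2 +
        φ₂ * (r ^ 2 * S ^ 2 + s ^ 2 * S ^ 2) * hI - φ₂ * s ^ 2 * hS
    constructor
    · linear_combination -c * hV₁ + d * hK₁
    · linear_combination -c * hV₂ + d * hK₂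

/-- The quadrature partner of a unit vector is a unit vector. -/
lemma norm_coinQuad (hs : 0 < s) {φ₁ φ₂ : ℂ} (hφ : ‖φ₁‖ ^ 2 + ‖φ₂‖ ^ 2 = 1) (θ : ℝ) :
    conj (coinQuad₀ r s φ₁ φ₂ θ) * coinQuad₀ r s φ₁ φ₂ θ +
      conj (coinQuad₁ r s φ₁ φ₂ θ) * coinQuad₁ r s φ₁ φ₂ θ = 1 := by
  have hw : (coinSin r s θ : ℂ) ≠ 0 := Complex.ofReal_ne_zero.2 (coinSin_pos hs θ).ne'
  have hw2 : (coinSin r s θ : ℂ) ^ 2 = s ^ 2 + r ^ 2 * (Real.sin θ : ℂ) ^ 2 := by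
    exact_mod_cast coinSin_sq r s θ
  have hI := Complex.I_sq
  have hS : (Real.sin θ : ℂ) ^ 2 + (Real.cos θ : ℂ) ^ 2 = 1 := by
    exact_mod_cast Real.sin_sq_add_cos_sq θ
  have hφ' : conj φ₁ * φ₁ + conj φ₂ * φ₂ = 1 := by
    rw [Complex.conj_mul', Complex.conj_mul']
    exact_mod_cast hφ
  simp only [coinQuad₀, coinQuad₁, exp_mul_I_eq, exp_neg_mul_I_eq, map_div₀, map_mul, map_add,
    map_sub, map_neg, Complex.conj_I, Complex.conj_ofReal]
  generalize (Real.cos θ : ℂ) = C at *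
  generalize (Real.sin θ : ℂ) = S at *
  generalize (coinSin r s θ : ℂ) = w at *
  generalize conj φ₁ = ψ₁ at *
  generalize conj φ₂ = ψ₂ at *
  field_simp
  linear_combination (s ^ 2 + r ^ 2 * S ^ 2) * hφ' - hw2 + s ^ 2 * (ψ₁ * φ₁ + ψ₂ * φ₂) * hS
    - (s ^ 2 + r ^ 2) * S ^ 2 * (ψ₁ * φ₁ + ψ₂ * φ₂) * hI

lemma inner_coinQuad (hs : 0 < s) (φ₁ φ₂ : ℂ) (θ : ℝ) :
    conj φ₁ * coinQuad₀ r s φ₁ φ₂ θ + conj φ₂ * coinQuad₁ r s φ₁ φ₂ θ =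
      coinPol r s φ₁ φ₂ θ * Complex.I := by
  have hw : (coinSin r s θ : ℂ) ≠ 0 := Complex.ofReal_ne_zero.2 (coinSin_pos hs θ).ne'
  simp only [coinQuad₀, coinQuad₁, coinPol, exp_mul_I_eq, exp_neg_mul_I_eq,
    Complex.sq_norm, Complex.normSq_apply, Complex.ofReal_div]
  field_simp
  apply Complex.ext <;> simp [-Complex.ofReal_sin, -Complex.ofReal_cos, pow_two] <;> ring

end RealCoin

section Correlation

variable {r s : ℝ}

/-- The inner product of the momentum-space states at momenta `θ` and `θ'` after `n` steps. -/
noncomputable def walkCorr (r s : ℝ) (φ₁ φ₂ : ℂ) (n : ℕ) (θ θ' : ℝ) : ℂ :=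
  conj (fourierSum (fun x => (qwEvol r s)^[n] (qwInit φ₁ φ₂) x 0) θ) *
      fourierSum (fun x => (qwEvol r s)^[n] (qwInit φ₁ φ₂) x 0) θ' +
    conj (fourierSum (fun x => (qwEvol r s)^[n] (qwInit φ₁ φ₂) x 1) θ) *
      fourierSum (fun x => (qwEvol r s)^[n] (qwInit φ₁ φ₂) x 1) θ'

lemma continuous_fourierSum {f : ℤ → ℂ} {S : Finset ℤ} (hf : ∀ x ∉ S, f x = 0) :
    Continuous (fourierSum f) := by
  have : fourierSum f = fun θ : ℝ => ∑ x ∈ S, f x * Complex.exp (x * θ * Complex.I) :=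
    funext fun θ => fourierSum_eq_sum hf θ
  rw [this]
  fun_prop

lemma qwEvol_iterate_apply_eq_zero (a b φ₁ φ₂ : ℂ) (n : ℕ) (i : Fin 2) :
    ∀ x ∉ Finset.Icc (-n : ℤ) n, (qwEvol a b)^[n] (qwInit φ₁ φ₂) x i = 0 := fun x hx => by
  simp [qwEvol_iterate_eq_zero a b φ₁ φ₂ n hx]

lemma continuous_walkCorr (r s : ℝ) (φ₁ φ₂ : ℂ) (n : ℕ) (δ : ℝ) :
    Continuous fun θ => walkCorr r s φ₁ φ₂ n θ (θ + δ) := by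
  have h0 := continuous_fourierSum (qwEvol_iterate_apply_eq_zero r s φ₁ φ₂ n 0)
  have h1 := continuous_fourierSum (qwEvol_iterate_apply_eq_zero r s φ₁ φ₂ n 1)
  unfold walkCorr
  fun_prop

lemma integral_walkCorr (r s : ℝ) (φ₁ φ₂ : ℂ) (n : ℕ) (c δ : ℝ) :
    ∫ θ in c..c + 2 * Real.pi, walkCorr r s φ₁ φ₂ n θ (θ + δ) =
      2 * Real.pi * ∑ x ∈ Finset.Icc (-n : ℤ) n,
        (qwProb r s φ₁ φ₂ n x : ℂ) * Complex.exp (x * δ * Complex.I) := by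
  have h0 := qwEvol_iterate_apply_eq_zero r s φ₁ φ₂ n 0
  have h1 := qwEvol_iterate_apply_eq_zero r s φ₁ φ₂ n 1
  have c0 := continuous_fourierSum h0
  have c1 := continuous_fourierSum h1
  unfold walkCorr
  rw [intervalIntegral.integral_add, integral_conj_fourierSum_mul h0,
    integral_conj_fourierSum_mul h1, ← mul_add, ← Finset.sum_add_distrib]
  · simp [qwProb, add_mul]
  all_goals exact Continuous.intervalIntegrable (by fun_prop) _ _

lemma walkCorr_eq (hr : 0 < r) (hs : 0 < s) (hrs : r ^ 2 + s ^ 2 = 1) {φ₁ φ₂ : ℂ}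
    (hφ : ‖φ₁‖ ^ 2 + ‖φ₂‖ ^ 2 = 1) (n : ℕ) (θ θ' : ℝ) :
    walkCorr r s φ₁ φ₂ n θ θ' =
      Real.cos (n * coinEnergy r θ' - n * coinEnergy r θ) +
      coinPol r s φ₁ φ₂ θ * Complex.I * Real.sin (n * coinEnergy r θ' - n * coinEnergy r θ) +
      ((Real.sin (n * coinEnergy r θ) * Real.sin (n * coinEnergy r θ') : ℝ) *
        (conj (coinQuad₀ r s φ₁ φ₂ θ) * coinQuad₀ r s φ₁ φ₂ θ' +
          conj (coinQuad₁ r s φ₁ φ₂ θ) * coinQuad₁ r s φ₁ φ₂ θ' - 1) +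
      (Real.cos (n * coinEnergy r θ) * Real.sin (n * coinEnergy r θ') : ℝ) *
        (conj φ₁ * coinQuad₀ r s φ₁ φ₂ θ' + conj φ₂ * coinQuad₁ r s φ₁ φ₂ θ' -
          coinPol r s φ₁ φ₂ θ * Complex.I)) := by
  have h1 := fourierSum_qwEvol_iterate hr hs hrs φ₁ φ₂ n θ
  have h2 := fourierSum_qwEvol_iterate hr hs hrs φ₁ φ₂ n θ'
  have hφ' : conj φ₁ * φ₁ + conj φ₂ * φ₂ = 1 := by
    rw [Complex.conj_mul', Complex.conj_mul']
    exact_mod_cast hφ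
  have hi : φ₁ * conj (coinQuad₀ r s φ₁ φ₂ θ) + φ₂ * conj (coinQuad₁ r s φ₁ φ₂ θ) =
      -(coinPol r s φ₁ φ₂ θ * Complex.I) := by
    simpa using congrArg conj (inner_coinQuad (r := r) hs φ₁ φ₂ θ)
  rw [walkCorr, h1.1, h1.2, h2.1, h2.2, Real.cos_sub, Real.sin_sub]
  simp only [map_add, map_mul, Complex.conj_ofReal, Complex.ofReal_add, Complex.ofReal_sub,
    Complex.ofReal_mul]
  linear_combination Real.cos (n * coinEnergy r θ) * Real.cos (n * coinEnergy r θ') * hφ' +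
    Real.sin (n * coinEnergy r θ) * Real.cos (n * coinEnergy r θ') * hi

lemma norm_walkCorr_le (hr : 0 < r) (hs : 0 < s) (hrs : r ^ 2 + s ^ 2 = 1) {φ₁ φ₂ : ℂ}
    (hφ : ‖φ₁‖ ^ 2 + ‖φ₂‖ ^ 2 = 1) (n : ℕ) (θ θ' : ℝ) :
    ‖walkCorr r s φ₁ φ₂ n θ θ'‖ ≤ 8 := by
  have hb : ∀ (x : ℝ) (z w : ℂ), ‖z‖ ≤ 1 → ‖w‖ ≤ 1 →
      ‖(Real.cos x : ℂ) * z + Real.sin x * w‖ ≤ 2 := by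
    intro x z w hz hw
    refine (norm_add_le _ _).trans ?_
    rw [norm_mul, norm_mul, Complex.norm_real, Complex.norm_real, Real.norm_eq_abs,
      Real.norm_eq_abs]
    nlinarith [Real.abs_cos_le_one x, Real.abs_sin_le_one x, norm_nonneg z, norm_nonneg w,
      abs_nonneg (Real.cos x), abs_nonneg (Real.sin x)]
  have hq : ∀ θ, ‖coinQuad₀ r s φ₁ φ₂ θ‖ ≤ 1 ∧ ‖coinQuad₁ r s φ₁ φ₂ θ‖ ≤ 1 := by
    intro θ
    have h := norm_coinQuad (r := r) hs hφ θ
    rw [Complex.conj_mul', Complex.conj_mul'] at h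
    have h' : ‖coinQuad₀ r s φ₁ φ₂ θ‖ ^ 2 + ‖coinQuad₁ r s φ₁ φ₂ θ‖ ^ 2 = 1 := by exact_mod_cast h
    constructor <;> nlinarith [norm_nonneg (coinQuad₀ r s φ₁ φ₂ θ),
      norm_nonneg (coinQuad₁ r s φ₁ φ₂ θ)]
  have hp : ‖φ₁‖ ≤ 1 ∧ ‖φ₂‖ ≤ 1 := by
    constructor <;> nlinarith [norm_nonneg φ₁, norm_nonneg φ₂]
  have h1 := fourierSum_qwEvol_iterate hr hs hrs φ₁ φ₂ n θ
  have h2 := fourierSum_qwEvol_iterate hr hs hrs φ₁ φ₂ n θ'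
  rw [walkCorr, h1.1, h1.2, h2.1, h2.2]
  have e1 := hb (n * coinEnergy r θ) _ _ hp.1 (hq θ).1
  have e2 := hb (n * coinEnergy r θ) _ _ hp.2 (hq θ).2
  have e3 := hb (n * coinEnergy r θ') _ _ hp.1 (hq θ').1
  have e4 := hb (n * coinEnergy r θ') _ _ hp.2 (hq θ').2
  refine (norm_add_le _ _).trans ?_
  rw [norm_mul, norm_mul, RCLike.norm_conj, RCLike.norm_conj]
  calc _ ≤ (2 : ℝ) * 2 + 2 * 2 := by gcongr
    _ = 8 := by norm_num

lemma tendsto_nat_mul_coinEnergy_sub (hr : 0 < r) (hs : 0 < s) (hrs : r ^ 2 + s ^ 2 = 1)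
    (θ t : ℝ) :
    Tendsto (fun n : ℕ => n * coinEnergy r (θ + t / n) - n * coinEnergy r θ) atTop
      (𝓝 (t * coinVelocity r s θ)) := by
  have h : HasDerivAt (fun u : ℝ => coinEnergy r (θ + u * t)) (coinVelocity r s θ * (1 * t)) 0 :=
    HasDerivAt.comp (0 : ℝ) (h₂ := coinEnergy r) (by simpa using hasDerivAt_coinEnergy hr hs hrs θ)
      (((hasDerivAt_id (0 : ℝ)).mul_const t).const_add θ)
  have h2 := (hasDerivAt_iff_tendsto_slope_zero.1 h).comp
    ((tendsto_inv_atTop_nhdsGT_zero.comp tendsto_natCast_atTop_atTop).mono_right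
      (nhdsGT_le_nhdsNE (0 : ℝ)))
  refine (h2.congr fun n => ?_).trans (by rw [one_mul, mul_comm])
  simp [div_eq_inv_mul, mul_sub]

lemma tendsto_ofReal_mul_zero {u : ℕ → ℝ} {v : ℕ → ℂ} (hu : ∀ n, |u n| ≤ 1)
    (hv : Tendsto v atTop (𝓝 0)) : Tendsto (fun n => (u n : ℂ) * v n) atTop (𝓝 0) := by
  refine squeeze_zero_norm (fun n => ?_) (by simpa using hv.norm)
  rw [norm_mul, Complex.norm_real, Real.norm_eq_abs]
  exact mul_le_of_le_one_left (norm_nonneg _) (hu n)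

lemma tendsto_walkCorr (hr : 0 < r) (hs : 0 < s) (hrs : r ^ 2 + s ^ 2 = 1) {φ₁ φ₂ : ℂ}
    (hφ : ‖φ₁‖ ^ 2 + ‖φ₂‖ ^ 2 = 1) (θ t : ℝ) :
    Tendsto (fun n : ℕ => walkCorr r s φ₁ φ₂ n θ (θ + t / n)) atTop
      (𝓝 (Real.cos (t * coinVelocity r s θ) +
        coinPol r s φ₁ φ₂ θ * Complex.I * Real.sin (t * coinVelocity r s θ))) := by
  simp_rw [walkCorr_eq hr hs hrs hφ]
  have hω := tendsto_nat_mul_coinEnergy_sub hr hs hrs θ t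
  have hθ : Tendsto (fun n : ℕ => θ + t / n) atTop (𝓝 θ) := by
    simpa using (tendsto_const_div_atTop_nhds_zero_nat t).const_add θ
  have hq0 := ((continuous_coinQuad₀ (r := r) hs φ₁ φ₂).tendsto θ).comp hθ
  have hq1 := ((continuous_coinQuad₁ (r := r) hs φ₁ φ₂).tendsto θ).comp hθ
  have hab : ∀ x y : ℝ, |x| ≤ 1 → |y| ≤ 1 → |x * y| ≤ 1 := fun x y hx hy => by
    rw [abs_mul]; exact mul_le_one₀ hx (abs_nonneg _) hy
  rw [← add_zero (_ + _ * _)]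
  refine Tendsto.add (Tendsto.add ?_ ?_) ?_
  · exact (Complex.continuous_ofReal.tendsto _).comp ((Real.continuous_cos.tendsto _).comp hω)
  · exact ((Complex.continuous_ofReal.tendsto _).comp
      ((Real.continuous_sin.tendsto _).comp hω)).const_mul _
  · rw [← add_zero (0 : ℂ)]
    refine Tendsto.add (tendsto_ofReal_mul_zero (fun n => hab _ _ (Real.abs_sin_le_one _)
      (Real.abs_sin_le_one _)) ?_) (tendsto_ofReal_mul_zero (fun n => hab _ _
      (Real.abs_cos_le_one _) (Real.abs_sin_le_one _)) ?_)
    · have := ((hq0.const_mul (conj (coinQuad₀ r s φ₁ φ₂ θ))).add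
        (hq1.const_mul (conj (coinQuad₁ r s φ₁ φ₂ θ)))).sub_const 1
      rwa [norm_coinQuad hs hφ θ, sub_self] at this
    · have := ((hq0.const_mul (conj φ₁)).add (hq1.const_mul (conj φ₂))).sub_const
        (coinPol r s φ₁ φ₂ θ * Complex.I)
      rwa [inner_coinQuad hs φ₁ φ₂ θ, sub_self] at this

/-- Convergence of the characteristic functions of the rescaled walk, in momentum space. -/
lemma tendsto_sum_qwProb_mul_exp (hr : 0 < r) (hs : 0 < s) (hrs : r ^ 2 + s ^ 2 = 1) {φ₁ φ₂ : ℂ}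
    (hφ : ‖φ₁‖ ^ 2 + ‖φ₂‖ ^ 2 = 1) (c t : ℝ) :
    Tendsto (fun n : ℕ => 2 * (Real.pi : ℂ) * ∑ x ∈ Finset.Icc (-n : ℤ) n,
        (qwProb r s φ₁ φ₂ n x : ℂ) * Complex.exp (x * (t / n : ℝ) * Complex.I)) atTop
      (𝓝 (∫ θ in c..c + 2 * Real.pi, ((Real.cos (t * coinVelocity r s θ) : ℂ) +
        coinPol r s φ₁ φ₂ θ * Complex.I * Real.sin (t * coinVelocity r s θ)))) := by
  simp_rw [← integral_walkCorr r s φ₁ φ₂ _ c]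
  refine intervalIntegral.tendsto_integral_filter_of_dominated_convergence (fun _ => 8) ?_ ?_ ?_ ?_
  · exact .of_forall fun n => (continuous_walkCorr r s φ₁ φ₂ n _).aestronglyMeasurable
  · exact .of_forall fun n => .of_forall fun θ _ => norm_walkCorr_le hr hs hrs hφ n _ _
  · exact intervalIntegrable_const
  · exact .of_forall fun θ _ => tendsto_walkCorr hr hs hrs hφ θ t

lemma sum_qwProb (hr : 0 < r) (hs : 0 < s) (hrs : r ^ 2 + s ^ 2 = 1) {φ₁ φ₂ : ℂ}
    (hφ : ‖φ₁‖ ^ 2 + ‖φ₂‖ ^ 2 = 1) (n : ℕ) :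
    ∑ x ∈ Finset.Icc (-n : ℤ) n, qwProb r s φ₁ φ₂ n x = 1 := by
  have h := integral_walkCorr r s φ₁ φ₂ n 0 0
  simp only [add_zero, walkCorr_eq hr hs hrs hφ, norm_coinQuad hs hφ, inner_coinQuad hs] at h
  have hpi : (Real.pi : ℂ) ≠ 0 := Complex.ofReal_ne_zero.2 Real.pi_ne_zero
  simp [hpi] at h
  exact_mod_cast h

end Correlation

section LimitMeasure

variable {r s : ℝ}

lemma coinSin_neg (r s θ : ℝ) : coinSin r s (-θ) = coinSin r s θ := by simp [coinSin]

lemma coinSin_pi_sub (r s θ : ℝ) : coinSin r s (Real.pi - θ) = coinSin r s θ := by simp [coinSin]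

lemma coinVelocity_neg (r s θ : ℝ) : coinVelocity r s (-θ) = -coinVelocity r s θ := by
  simp [coinVelocity, coinSin_neg, neg_div]

lemma coinVelocity_pi_sub (r s θ : ℝ) : coinVelocity r s (Real.pi - θ) = coinVelocity r s θ := by
  simp [coinVelocity, coinSin_pi_sub]

/-- The asymmetry parameter of the limit law for the real coin. -/
noncomputable def coinAsym (r s : ℝ) (φ₁ φ₂ : ℂ) : ℝ :=
  ‖φ₁‖ ^ 2 - ‖φ₂‖ ^ 2 - 2 * s * (conj φ₁ * φ₂).re / r

lemma coinPol_add_pi_sub (hr : 0 < r) (φ₁ φ₂ : ℂ) (θ : ℝ) :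
    coinPol r s φ₁ φ₂ θ + coinPol r s φ₁ φ₂ (Real.pi - θ) =
      2 * (coinAsym r s φ₁ φ₂ * coinVelocity r s θ) := by
  simp only [coinPol, coinAsym, coinVelocity, coinSin_pi_sub, Real.sin_pi_sub, Real.cos_pi_sub]
  field_simp
  ring

lemma integral_eq_zero_of_odd {f : ℝ → ℂ} (hf : ∀ x, f (-x) = -f x) (c : ℝ) :
    ∫ x in -c..c, f x = 0 := by
  have h := intervalIntegral.integral_comp_neg (a := -c) (b := c) f
  simp only [hf, intervalIntegral.integral_neg, neg_neg] at h
  exact self_eq_neg.1 h.symm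

lemma integral_coinPol (hr : 0 < r) (hs : 0 < s) (φ₁ φ₂ : ℂ) (t : ℝ) :
    ∫ θ in (-(Real.pi / 2))..-(Real.pi / 2) + 2 * Real.pi,
      ((Real.cos (t * coinVelocity r s θ) : ℂ) +
        coinPol r s φ₁ φ₂ θ * Complex.I * Real.sin (t * coinVelocity r s θ)) =
    2 * ∫ θ in (-(Real.pi / 2))..Real.pi / 2,
      (1 + coinAsym r s φ₁ φ₂ * coinVelocity r s θ : ℝ) *
        Complex.exp (t * coinVelocity r s θ * Complex.I) := by
  have hv := continuous_coinVelocity (r := r) hs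
  have hp := continuous_coinPol (r := r) hs φ₁ φ₂
  set G : ℝ → ℂ := fun θ => (Real.cos (t * coinVelocity r s θ) : ℂ) +
        coinPol r s φ₁ φ₂ θ * Complex.I * Real.sin (t * coinVelocity r s θ) with hG
  have hGc : Continuous G := by fun_prop
  have hsplit : ∫ θ in (-(Real.pi / 2))..-(Real.pi / 2) + 2 * Real.pi, G θ =
      ∫ θ in (-(Real.pi / 2))..Real.pi / 2, (G θ + G (Real.pi - θ)) := by
    rw [intervalIntegral.integral_add (hGc.intervalIntegrable _ _)
      (Continuous.intervalIntegrable (by fun_prop) _ _),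
      intervalIntegral.integral_comp_sub_left,
      ← intervalIntegral.integral_add_adjacent_intervals (hGc.intervalIntegrable _ (Real.pi / 2))
        (hGc.intervalIntegrable _ _)]
    congr 2 <;> ring
  rw [hsplit, ← intervalIntegral.integral_const_mul, ← sub_eq_zero,
    ← intervalIntegral.integral_sub (Continuous.intervalIntegrable (by fun_prop) _ _)
      (Continuous.intervalIntegrable (by fun_prop) _ _)]
  have key : ∀ θ, G θ + G (Real.pi - θ) - 2 * ((1 + coinAsym r s φ₁ φ₂ * coinVelocity r s θ : ℝ) *
        Complex.exp (t * coinVelocity r s θ * Complex.I)) =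
      -2 * (coinAsym r s φ₁ φ₂ * coinVelocity r s θ * Real.cos (t * coinVelocity r s θ) +
        Complex.I * Real.sin (t * coinVelocity r s θ)) := by
    intro θ
    have h : (coinPol r s φ₁ φ₂ θ : ℂ) + coinPol r s φ₁ φ₂ (Real.pi - θ) =
      2 * (coinAsym r s φ₁ φ₂ * coinVelocity r s θ) := by
      exact_mod_cast coinPol_add_pi_sub hr φ₁ φ₂ θ
    have he := exp_mul_I_eq (t * coinVelocity r s θ)
    rw [Complex.ofReal_mul] at he
    rw [he]
    simp only [hG, coinVelocity_pi_sub, Complex.ofReal_add, Complex.ofReal_one, Complex.ofReal_mul]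
    linear_combination (Complex.I * Real.sin (t * coinVelocity r s θ)) * h
  simp_rw [key]
  apply integral_eq_zero_of_odd
  intro θ
  simp only [coinVelocity_neg, mul_neg, Real.cos_neg, Real.sin_neg, Complex.ofReal_neg]
  ring

lemma coinVelocity_sq (hs : 0 < s) (hrs : r ^ 2 + s ^ 2 = 1) (θ : ℝ) :
    r ^ 2 - coinVelocity r s θ ^ 2 = (r * s * Real.cos θ / coinSin r s θ) ^ 2 := by
  have hw := (coinSin_pos (r := r) hs θ).ne'
  rw [coinVelocity, div_pow, div_pow, eq_div_iff (pow_ne_zero 2 hw), sub_mul,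
    div_mul_cancel₀ _ (pow_ne_zero 2 hw), coinSin_sq]
  linear_combination r ^ 2 * Real.sin θ ^ 2 * hrs - r ^ 2 * s ^ 2 * Real.sin_sq_add_cos_sq θ

lemma one_sub_coinVelocity_sq (hs : 0 < s) (θ : ℝ) :
    1 - coinVelocity r s θ ^ 2 = s ^ 2 / coinSin r s θ ^ 2 := by
  have hw := (coinSin_pos (r := r) hs θ).ne'
  rw [coinVelocity, div_pow, eq_div_iff (pow_ne_zero 2 hw), sub_mul,
    div_mul_cancel₀ _ (pow_ne_zero 2 hw), coinSin_sq]
  ring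

lemma one_add_coinAsym_mul_nonneg (hr : 0 < r) (hs : 0 < s) (hrs : r ^ 2 + s ^ 2 = 1) {φ₁ φ₂ : ℂ}
    (hφ : ‖φ₁‖ ^ 2 + ‖φ₂‖ ^ 2 = 1) (θ : ℝ) :
    0 ≤ 1 + coinAsym r s φ₁ φ₂ * coinVelocity r s θ := by
  have hY : |coinVelocity r s θ| ≤ r := by
    apply abs_le_of_sq_le_sq _ hr.le
    nlinarith [coinVelocity_sq hs hrs θ, sq_nonneg (r * s * Real.cos θ / coinSin r s θ)]
  have hc : (conj φ₁ * φ₂).re ^ 2 ≤ ‖φ₁‖ ^ 2 * ‖φ₂‖ ^ 2 := by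
    rw [← mul_pow, ← RCLike.norm_conj φ₁, ← norm_mul]
    exact sq_le_sq.2 ((Complex.abs_re_le_norm _).trans (le_abs_self _))
  have hl : |coinAsym r s φ₁ φ₂ * r| ≤ 1 := by
    have : coinAsym r s φ₁ φ₂ * r =
        r * (‖φ₁‖ ^ 2 - ‖φ₂‖ ^ 2) - s * (2 * (conj φ₁ * φ₂).re) := by
      rw [coinAsym]; field_simp
    rw [this]
    apply abs_le_of_sq_le_sq _ zero_le_one
    generalize (conj φ₁ * φ₂).re = c at *
    generalize ‖φ₁‖ ^ 2 = p at *
    generalize ‖φ₂‖ ^ 2 = q at *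
    have h1 : (r * (p - q) - s * (2 * c)) ^ 2 ≤ (r ^ 2 + s ^ 2) * ((p - q) ^ 2 + (2 * c) ^ 2) := by
      nlinarith [sq_nonneg (r * (2 * c) + s * (p - q))]
    rw [hrs] at h1
    nlinarith [congrArg (· ^ 2) hφ]
  have h3 : |coinAsym r s φ₁ φ₂ * coinVelocity r s θ| ≤ 1 := by
    rw [abs_mul] at hl ⊢
    rw [abs_of_pos hr] at hl
    exact (mul_le_mul_of_nonneg_left hY (abs_nonneg _)).trans hl
  linarith [(abs_le.1 h3).1]

lemma hasDerivAt_coinVelocity (hs : 0 < s) (θ : ℝ) :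
    HasDerivAt (coinVelocity r s) (r * Real.cos θ * s ^ 2 / coinSin r s θ ^ 3) θ := by
  have hw := coinSin_pos (r := r) hs θ
  have hw2 := coinSin_sq r s θ
  have h1 : HasDerivAt (coinSin r s)
      (r ^ 2 * (2 * Real.sin θ * Real.cos θ) / (2 * coinSin r s θ)) θ := by
    have := ((((Real.hasDerivAt_sin θ).pow 2).const_mul (r ^ 2)).const_add (s ^ 2)).sqrt
      (show s ^ 2 + r ^ 2 * Real.sin θ ^ 2 ≠ 0 by positivity)
    refine this.congr_deriv ?_
    simp [coinSin]
  have h2 := ((Real.hasDerivAt_sin θ).const_mul r).div h1 hw.ne'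
  refine h2.congr_deriv ?_
  field_simp
  linear_combination r * Real.cos θ * hw2

lemma coinVelocity_pi_div_two (hrs : r ^ 2 + s ^ 2 = 1) : coinVelocity r s (Real.pi / 2) = r := by
  have : coinSin r s (Real.pi / 2) = 1 := by
    simp [coinSin, add_comm (s ^ 2), hrs]
  simp [coinVelocity, this]

lemma strictMonoOn_coinVelocity (hr : 0 < r) (hs : 0 < s) :
    StrictMonoOn (coinVelocity r s) (Set.Icc (-(Real.pi / 2)) (Real.pi / 2)) := by
  refine strictMonoOn_of_deriv_pos (convex_Icc _ _) (continuous_coinVelocity hs).continuousOn ?_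
  intro θ hθ
  rw [interior_Icc] at hθ
  rw [(hasDerivAt_coinVelocity hs θ).deriv]
  have := Real.cos_pos_of_mem_Ioo hθ
  have := coinSin_pos (r := r) hs θ
  positivity

lemma image_coinVelocity (hr : 0 < r) (hs : 0 < s) (hrs : r ^ 2 + s ^ 2 = 1) :
    coinVelocity r s '' Set.Ioo (-(Real.pi / 2)) (Real.pi / 2) = Set.Ioo (-r) r := by
  have hpi : -(Real.pi / 2) ≤ Real.pi / 2 := by linarith [Real.pi_pos]
  have e1 := coinVelocity_pi_div_two hrs
  have e2 : coinVelocity r s (-(Real.pi / 2)) = -r := by rw [coinVelocity_neg, e1]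
  have hm := strictMonoOn_coinVelocity hr hs
  refine Set.Subset.antisymm ?_ ?_
  · rintro _ ⟨θ, hθ, rfl⟩
    exact ⟨e2.symm.trans_lt (hm ⟨le_rfl, hpi⟩ (Set.Ioo_subset_Icc_self hθ) hθ.1),
      (hm (Set.Ioo_subset_Icc_self hθ) ⟨hpi, le_rfl⟩ hθ.2).trans_eq e1⟩
  · have := intermediate_value_Ioo hpi (continuous_coinVelocity (r := r) hs).continuousOn
    rwa [e1, e2] at this

/-- Change of variables from momentum to group velocity. -/
lemma integral_coinVelocity (hr : 0 < r) (hs : 0 < s) (hrs : r ^ 2 + s ^ 2 = 1) (f : ℝ → ℝ)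
    (l : ℝ) :
    ∫ y in (-r)..r, f y * (s * (1 + l * y) / (Real.pi * (1 - y ^ 2) * √(r ^ 2 - y ^ 2))) =
      ∫ θ in (-(Real.pi / 2))..Real.pi / 2,
        ((1 + l * coinVelocity r s θ) / Real.pi) * f (coinVelocity r s θ) := by
  have hpi : -(Real.pi / 2) ≤ Real.pi / 2 := by linarith [Real.pi_pos]
  rw [intervalIntegral.integral_of_le (by linarith), intervalIntegral.integral_of_le hpi,
    integral_Ioc_eq_integral_Ioo, integral_Ioc_eq_integral_Ioo, ← image_coinVelocity hr hs hrs,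
    integral_image_eq_integral_abs_deriv_smul measurableSet_Ioo
      (fun θ _ => (hasDerivAt_coinVelocity hs θ).hasDerivWithinAt)
      ((strictMonoOn_coinVelocity hr hs).injOn.mono Set.Ioo_subset_Icc_self)]
  refine setIntegral_congr_fun measurableSet_Ioo fun θ hθ => ?_
  have hc := Real.cos_pos_of_mem_Ioo hθ
  have hw := coinSin_pos (r := r) hs θ
  have hπ := Real.pi_pos
  simp only [smul_eq_mul]
  rw [abs_of_pos (by positivity), coinVelocity_sq hs hrs, one_sub_coinVelocity_sq hs,
    Real.sqrt_sq (by positivity)]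
  field_simp

/-- The limit law of the walk with a real coin, as the law of the group velocity. -/
noncomputable def limitMeasure (r s l : ℝ) : Measure ℝ :=
  ((volume.restrict (Set.Ioc (-(Real.pi / 2)) (Real.pi / 2))).withDensity fun θ =>
    ENNReal.ofReal ((1 + l * coinVelocity r s θ) / Real.pi)).map (coinVelocity r s)

lemma integral_limitMeasure {E : Type*} [NormedAddCommGroup E] [NormedSpace ℝ E]
    [SecondCountableTopology E] {l : ℝ} (hs : 0 < s)
    (hl : ∀ θ, 0 ≤ 1 + l * coinVelocity r s θ) {g : ℝ → E} (hg : Continuous g) :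
    ∫ y, g y ∂limitMeasure r s l =
      ∫ θ in (-(Real.pi / 2))..Real.pi / 2,
        ((1 + l * coinVelocity r s θ) / Real.pi) • g (coinVelocity r s θ) := by
  have hv := continuous_coinVelocity (r := r) hs
  have hpi : -(Real.pi / 2) ≤ Real.pi / 2 := by linarith [Real.pi_pos]
  rw [limitMeasure, integral_map hv.aemeasurable hg.aestronglyMeasurable,
    integral_withDensity_eq_integral_toReal_smul (by fun_prop) (by simp),
    intervalIntegral.integral_of_le hpi]
  refine integral_congr_ae (.of_forall fun θ => ?_)
  beta_reduce
  rw [ENNReal.toReal_ofReal (div_nonneg (hl θ) Real.pi_pos.le)]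

lemma isFiniteMeasure_limitMeasure (hs : 0 < s) (l : ℝ) :
    IsFiniteMeasure (limitMeasure r s l) := by
  have hv := continuous_coinVelocity (r := r) hs
  have : IsFiniteMeasure ((volume.restrict (Set.Ioc (-(Real.pi / 2)) (Real.pi / 2))).withDensity
      fun θ => ENNReal.ofReal ((1 + l * coinVelocity r s θ) / Real.pi)) := by
    apply isFiniteMeasure_withDensity_ofReal
    exact (Continuous.integrableOn_Ioc (by fun_prop)).2
  exact Measure.isFiniteMeasure_map _ _

lemma charFun_limitMeasure (hr : 0 < r) (hs : 0 < s) (hrs : r ^ 2 + s ^ 2 = 1) {φ₁ φ₂ : ℂ}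
    (hφ : ‖φ₁‖ ^ 2 + ‖φ₂‖ ^ 2 = 1) (t : ℝ) :
    2 * Real.pi * charFun (limitMeasure r s (coinAsym r s φ₁ φ₂)) t =
      ∫ θ in (-(Real.pi / 2))..-(Real.pi / 2) + 2 * Real.pi,
        ((Real.cos (t * coinVelocity r s θ) : ℂ) +
          coinPol r s φ₁ φ₂ θ * Complex.I * Real.sin (t * coinVelocity r s θ)) := by
  have hpi : (Real.pi : ℂ) ≠ 0 := Complex.ofReal_ne_zero.2 Real.pi_ne_zero
  rw [integral_coinPol hr hs, charFun_apply_real,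
    integral_limitMeasure hs (one_add_coinAsym_mul_nonneg hr hs hrs hφ) (by fun_prop), mul_assoc,
    ← intervalIntegral.integral_const_mul]
  congr 1
  refine intervalIntegral.integral_congr fun θ _ => ?_
  simp only [Complex.real_smul, Complex.ofReal_div]
  field_simp

/-- The law of the rescaled position after `n` steps. -/
noncomputable def walkMeasure (r s : ℝ) (φ₁ φ₂ : ℂ) (n : ℕ) : Measure ℝ :=
  ∑ x ∈ Finset.Icc (-n : ℤ) n,
    ENNReal.ofReal (qwProb r s φ₁ φ₂ n x) • Measure.dirac ((x : ℝ) / n)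

lemma qwProb_nonneg (a b φ₁ φ₂ : ℂ) (n : ℕ) (x : ℤ) : 0 ≤ qwProb a b φ₁ φ₂ n x := by
  unfold qwProb; positivity

lemma integral_walkMeasure {E : Type*} [NormedAddCommGroup E] [NormedSpace ℝ E] [CompleteSpace E]
    (r s : ℝ) (φ₁ φ₂ : ℂ) (n : ℕ) (g : ℝ → E) :
    ∫ y, g y ∂walkMeasure r s φ₁ φ₂ n =
      ∑ x ∈ Finset.Icc (-n : ℤ) n, qwProb r s φ₁ φ₂ n x • g (x / n) := by
  rw [walkMeasure, integral_finsetSum_measure]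
  · simp [integral_smul_measure, ENNReal.toReal_ofReal (qwProb_nonneg _ _ _ _ _ _)]
  · exact fun x _ => (integrable_dirac (by simp)).smul_measure ENNReal.ofReal_ne_top

lemma isProbabilityMeasure_walkMeasure (hr : 0 < r) (hs : 0 < s) (hrs : r ^ 2 + s ^ 2 = 1)
    {φ₁ φ₂ : ℂ} (hφ : ‖φ₁‖ ^ 2 + ‖φ₂‖ ^ 2 = 1) (n : ℕ) :
    IsProbabilityMeasure (walkMeasure r s φ₁ φ₂ n) := by
  constructor
  simp only [walkMeasure, Measure.coe_finsetSum, Finset.sum_apply, Measure.smul_apply,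
    measure_univ, smul_eq_mul, mul_one]
  rw [← ENNReal.ofReal_sum_of_nonneg fun _ _ => qwProb_nonneg _ _ _ _ _ _,
    sum_qwProb hr hs hrs hφ, ENNReal.ofReal_one]

lemma tendsto_charFun_walkMeasure (hr : 0 < r) (hs : 0 < s) (hrs : r ^ 2 + s ^ 2 = 1)
    {φ₁ φ₂ : ℂ} (hφ : ‖φ₁‖ ^ 2 + ‖φ₂‖ ^ 2 = 1) (t : ℝ) :
    Tendsto (fun n => charFun (walkMeasure r s φ₁ φ₂ n) t) atTop
      (𝓝 (charFun (limitMeasure r s (coinAsym r s φ₁ φ₂)) t)) := by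
  have hpi : 2 * (Real.pi : ℂ) ≠ 0 := by simp [Real.pi_ne_zero]
  have h := tendsto_sum_qwProb_mul_exp hr hs hrs hφ (-(Real.pi / 2)) t
  rw [← charFun_limitMeasure hr hs hrs hφ] at h
  refine ((h.const_mul (2 * (Real.pi : ℂ))⁻¹).congr fun n => ?_).trans ?_
  · rw [inv_mul_cancel_left₀ hpi, charFun_apply_real, integral_walkMeasure]
    refine Finset.sum_congr rfl fun x _ => ?_
    rw [Complex.real_smul]
    congr 2
    push_cast
    ring
  · rw [inv_mul_cancel_left₀ hpi]

/-- The weak limit theorem for a real coin. -/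
lemma tendsto_sum_qwProb_real (hr : 0 < r) (hs : 0 < s) (hrs : r ^ 2 + s ^ 2 = 1)
    {φ₁ φ₂ : ℂ} (hφ : ‖φ₁‖ ^ 2 + ‖φ₂‖ ^ 2 = 1) {f : ℝ → ℝ} (hf : Continuous f)
    (hfb : ∃ C, ∀ y, |f y| ≤ C) :
    Tendsto (fun n : ℕ => ∑' x : ℤ, qwProb r s φ₁ φ₂ n x * f ((x : ℝ) / n)) atTop
      (𝓝 (∫ y in (-r)..r, f y * (s * (1 + coinAsym r s φ₁ φ₂ * y) /
        (Real.pi * (1 - y ^ 2) * √(r ^ 2 - y ^ 2))))) := by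
  obtain ⟨C, hC⟩ := hfb
  have hW := isProbabilityMeasure_walkMeasure hr hs hrs hφ
  have := isFiniteMeasure_limitMeasure (r := r) hs (coinAsym r s φ₁ φ₂)
  have hcf := tendsto_charFun_walkMeasure hr hs hrs hφ
  have hL : IsProbabilityMeasure (limitMeasure r s (coinAsym r s φ₁ φ₂)) := by
    have h0 := hcf 0
    simp only [charFun_zero, probReal_univ] at h0
    have h1 : ((1 : ℝ) : ℂ) = _ := tendsto_nhds_unique tendsto_const_nhds h0
    rw [Complex.ofReal_inj] at h1
    exact isProbabilityMeasure_iff_real.2 h1.symm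
  have hconv := ProbabilityMeasure.tendsto_iff_forall_integral_tendsto.1
    (ProbabilityMeasure.tendsto_of_tendsto_charFun
      (μ := fun n => ⟨walkMeasure r s φ₁ φ₂ n, hW n⟩) (μ₀ := ⟨_, hL⟩) hcf)
    (BoundedContinuousFunction.ofNormedAddCommGroup f hf C hC)
  simp only [BoundedContinuousFunction.coe_ofNormedAddCommGroup, ProbabilityMeasure.coe_mk,
    integral_walkMeasure, smul_eq_mul] at hconv
  rw [integral_limitMeasure hs (one_add_coinAsym_mul_nonneg hr hs hrs hφ) hf] at hconv
  simp only [smul_eq_mul] at hconv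
  rw [← integral_coinVelocity hr hs hrs] at hconv
  refine hconv.congr fun n => (tsum_eq_sum fun x hx => ?_).symm
  simp [qwProb, qwEvol_iterate_eq_zero _ _ _ _ n hx]

end LimitMeasure

/-- Konno's weak limit theorem for one-dimensional quantum walks. -/
theorem konno_weak_limit (a b : ℂ) (ha : a ≠ 0) (hb : b ≠ 0)
    (hab : ‖a‖ ^ 2 + ‖b‖ ^ 2 = 1)
    (φ₁ φ₂ : ℂ) (hφ : ‖φ₁‖ ^ 2 + ‖φ₂‖ ^ 2 = 1)
    (lam : ℝ)
    (hlam : lam = ‖φ₁‖ ^ 2 - ‖φ₂‖ ^ 2 -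
      ((a * b * (starRingEnd ℂ) φ₁ * φ₂ +
        (starRingEnd ℂ) a * (starRingEnd ℂ) b * φ₁ * (starRingEnd ℂ) φ₂).re) / ‖a‖ ^ 2)
    (f : ℝ → ℝ) (hf : Continuous f) (hfb : ∃ C, ∀ y, |f y| ≤ C) :
    Filter.Tendsto
      (fun n : ℕ => ∑' x : ℤ, qwProb a b φ₁ φ₂ n x * f ((x : ℝ) / n))
      Filter.atTop
      (nhds (∫ y in (-‖a‖)..‖a‖,
        f y * (‖b‖ * (1 + lam * y) /
          (Real.pi * (1 - y ^ 2) * Real.sqrt (‖a‖ ^ 2 - y ^ 2))))) := by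
  have ha' : (‖a‖ : ℂ) ≠ 0 := by simpa using ha
  have hb' : (‖b‖ : ℂ) ≠ 0 := by simpa using hb
  have hca := Complex.conj_mul' a
  have hu : ‖conj a / ‖a‖‖ = 1 := by simp [ha]
  have hv : ‖b * a / (‖a‖ * ‖b‖)‖ = 1 := by
    simp only [norm_mul, norm_div, Complex.norm_real, norm_norm]
    field_simp
  have hr := norm_pos_iff.2 ha
  have hs := norm_pos_iff.2 hb
  have hA : a * (conj a / ‖a‖) = (‖a‖ : ℂ) := by
    field_simp
    linear_combination hca
  have hB : b * (conj a / ‖a‖)⁻¹ * (b * a / (‖a‖ * ‖b‖))⁻¹ = (‖b‖ : ℂ) := by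
    have hc0 : conj a ≠ 0 := by simpa using ha
    field_simp
    linear_combination -hca
  have hφ' : ‖φ₁‖ ^ 2 + ‖b * a / (‖a‖ * ‖b‖) * φ₂‖ ^ 2 = 1 := by
    rw [norm_mul, hv, one_mul, hφ]
  have hl : coinAsym ‖a‖ ‖b‖ φ₁ (b * a / (‖a‖ * ‖b‖) * φ₂) = lam := by
    have h1 : conj φ₁ * (b * a / (‖a‖ * ‖b‖) * φ₂) =
        ((‖a‖ * ‖b‖)⁻¹ : ℝ) * (a * b * conj φ₁ * φ₂) := by
      push_cast
      ring
    have h2 : conj a * conj b * φ₁ * conj φ₂ = conj (a * b * conj φ₁ * φ₂) := by simp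
    rw [hlam, coinAsym, h1, h2, norm_mul, hv, Complex.re_ofReal_mul, Complex.add_re,
      Complex.conj_re]
    field_simp
    ring
  have main := tendsto_sum_qwProb_real hr hs hab hφ' hf hfb
  have hg := qwProb_gauge hu hv a b φ₁ φ₂
  rw [hA, hB] at hg
  simpa only [hl, hg] using main
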